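/- arXiv:1902.02526 — 2 statements merged into one kernel-verified Lean document; each statement's English description precedes it below -/
import Mathlib

section
/- Let k be a positive integer, let G be a graph and let H be an induced subgraph of G with δ(H) ≥ max{5k−3, |V(H)|−k}. Suppose G has an extended system of T-segments {P_1,…,P_r} with terminal set T = V(H) such that the total number of vertices of the paths lying outside V(H) equals p, where p ≤ k−1. Then G contains a path with at least |V(H)|+p vertices. -/
open SimpleGraph

/-- A (simple) path in `G`, packaged with its two end-vertices. -/
structure PathIn {V : Type*} (G : SimpleGraph V) where
  first : V
  last : V
  walk : G.Walk first last
  isPath : walk.IsPath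

namespace PathIn

variable {V : Type*} {G : SimpleGraph V}

/-- The vertex set of the path. -/
def verts (P : PathIn G) : Set V := {x | x ∈ P.walk.support}

/-- The internal (non-end) vertices of the path. -/
def internals (P : PathIn G) : Set V := {x | x ∈ P.walk.support.tail.dropLast}

/-- `x` is an end-vertex of the path. -/
def IsEndpoint (P : PathIn G) (x : V) : Prop := x = P.first ∨ x = P.last

end PathIn

/-- A path `P` is a one-terminal `T`-segment if it has at least 2 vertices, exactly
one of its end-vertices is in `T`, and all its other vertices are outside `T`. -/
def IsOneTerminalSegment {V : Type*} (G : SimpleGraph V) (T : Set V) (P : PathIn G) : Prop :=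
  2 ≤ P.walk.support.length ∧
    ((P.first ∈ T ∧ ∀ x ∈ P.walk.support.tail, x ∉ T) ∨
     (P.last ∈ T ∧ ∀ x ∈ P.walk.support.dropLast, x ∉ T))

/-- A path `P` is a two-terminal `T`-segment if it has at least 3 vertices, both of
its end-vertices are in `T`, and all its internal vertices are outside `T`. -/
def IsTwoTerminalSegment {V : Type*} (G : SimpleGraph V) (T : Set V) (P : PathIn G) : Prop :=
  3 ≤ P.walk.support.length ∧ P.first ∈ T ∧ P.last ∈ T ∧ ∀ x ∈ P.internals, x ∉ T

/-- The union of a family of paths, as a simple graph on the vertices of `G`. -/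
def segUnionGraph {V : Type*} {G : SimpleGraph V} {r : ℕ} (P : Fin r → PathIn G) :
    SimpleGraph V :=
  (⨆ i, (P i).walk.toSubgraph).spanningCoe

/-- A linear forest: a graph each of whose connected components is a path,
equivalently (for finite graphs) an acyclic graph of maximum degree at most 2. -/
def IsLinearForest {V : Type*} (F : SimpleGraph V) : Prop :=
  F.IsAcyclic ∧ ∀ v : V, (F.neighborSet v).ncard ≤ 2

/-- The paths `P i` are pairwise internally vertex-disjoint: a common vertex of two
of the paths must be an end-vertex of both. -/
def InternallyDisjoint {V : Type*} {G : SimpleGraph V} {r : ℕ} (P : Fin r → PathIn G) : Prop :=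
  ∀ i j : Fin r, i ≠ j → ∀ x : V, x ∈ (P i).verts → x ∈ (P j).verts →
    (P i).IsEndpoint x ∧ (P j).IsEndpoint x

/-- A system of `T`-segments: a family of two-terminal `T`-segments that are pairwise
internally vertex-disjoint and whose union is a linear forest. -/
def IsSegmentSystem {V : Type*} (G : SimpleGraph V) (T : Set V) {r : ℕ}
    (P : Fin r → PathIn G) : Prop :=
  (∀ i, IsTwoTerminalSegment G T (P i)) ∧
  InternallyDisjoint P ∧
  IsLinearForest (segUnionGraph P)

/-- An extended system of `T`-segments: (i) at least one and at most two of the paths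
are one-terminal `T`-segments and the remaining ones are two-terminal `T`-segments;
(ii) the paths are pairwise internally vertex-disjoint and the end-vertex outside `T`
of each one-terminal segment is distinct from all other vertices of the paths;
(iii) the union of the paths is a linear forest, and if there are two one-terminal
segments then their vertices lie in distinct components of this forest. -/
def IsExtendedSegmentSystem {V : Type*} (G : SimpleGraph V) (T : Set V) {r : ℕ}
    (P : Fin r → PathIn G) : Prop :=
  (∃ i, IsOneTerminalSegment G T (P i)) ∧
  (∀ i j l : Fin r, IsOneTerminalSegment G T (P i) → IsOneTerminalSegment G T (P j) →
      IsOneTerminalSegment G T (P l) → i = j ∨ i = l ∨ j = l) ∧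
  (∀ i, IsOneTerminalSegment G T (P i) ∨ IsTwoTerminalSegment G T (P i)) ∧
  InternallyDisjoint P ∧
  (∀ i, IsOneTerminalSegment G T (P i) → ∀ x : V, (P i).IsEndpoint x → x ∉ T →
      ∀ j, j ≠ i → x ∉ (P j).verts) ∧
  IsLinearForest (segUnionGraph P) ∧
  (∀ i j : Fin r, i ≠ j → IsOneTerminalSegment G T (P i) → IsOneTerminalSegment G T (P j) →
      ∀ x ∈ (P i).verts, ∀ y ∈ (P j).verts, ¬ (segUnionGraph P).Reachable x y)

/-- The total number of vertices of the paths of the family lying outside `T`. -/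
noncomputable def outsideCount {V : Type*} {G : SimpleGraph V} {r : ℕ} (T : Set V)
    (P : Fin r → PathIn G) : ℕ :=
  ((⋃ i, (P i).verts) \ T).ncard

/-- `H` is a `d`-core of `G`: an inclusion-maximal vertex set inducing a connected
subgraph of minimum degree at least `d`. -/
def IsDCore {V : Type*} (G : SimpleGraph V) (d : ℕ) (H : Set V) : Prop :=
  (G.induce H).Connected ∧
  (∀ v ∈ H, d ≤ (G.neighborSet v ∩ H).ncard) ∧
  ∀ H' : Set V, H ⊆ H' → (G.induce H').Connected →
    (∀ v ∈ H', d ≤ (G.neighborSet v ∩ H').ncard) → H' = H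

/-- Either two consecutive entries `x, y` of `a :: l` satisfy `A x` and `B y`, or the entries
violating `A` or `B` are numerous. -/
theorem List.exists_consecutive_or_length_le_countP {α : Type*} (A B : α → Prop)
    [DecidablePred A] [DecidablePred B] (a : α) (l : List α) :
    (∃ l₁ x y l₂, a :: l = l₁ ++ x :: y :: l₂ ∧ A x ∧ B y) ∨
      l.length ≤ (a :: l).dropLast.countP (fun x => ¬ A x) + l.countP (fun y => ¬ B y) := by
  induction l generalizing a with
  | nil => simp
  | cons b l ih =>
    by_cases hab : A a ∧ B b
    · exact Or.inl ⟨[], a, b, l, rfl, hab⟩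
    · rcases ih b with ⟨l₁, x, y, l₂, h, hx⟩ | h
      · exact Or.inl ⟨a :: l₁, x, y, l₂, by simp [h], hx⟩
      · right
        rw [List.dropLast_cons_cons, List.countP_cons, List.countP_cons, List.length_cons]
        by_cases hA : A a <;> by_cases hB : B b <;> simp_all <;> omega

/-- In a list without two consecutive entries satisfying `p`, at most one more entry satisfies `p`
than violates it. -/
theorem List.IsChain.countP_le_countP_not_add_one {α : Type*} (p : α → Prop) [DecidablePred p]
    {l : List α} (h : l.IsChain (fun x y => ¬ (p x ∧ p y))) :
    l.countP (fun x => p x) ≤ l.countP (fun x => ¬ p x) + 1 := by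
  have key : ∀ (a : α) (l : List α), (a :: l).IsChain (fun x y => ¬ (p x ∧ p y)) →
      (a :: l).countP (fun x => p x) ≤
        (a :: l).countP (fun x => ¬ p x) + (if p a then 1 else 0) := by
    intro a l
    induction l generalizing a with
    | nil => simp
    | cons b l ih =>
      intro h
      rw [List.isChain_cons_cons] at h
      have := ih b h.2
      rw [List.countP_cons, List.countP_cons (l := b :: l)]
      have h1 := h.1
      by_cases ha : p a <;> by_cases hb : p b <;> simp_all <;> omega
  cases l with
  | nil => simp
  | cons a l =>
    have := key a l h
    split_ifs at this <;> omega

/-- A nodup list whose entries satisfying `p` lie in a finset has `countP` at most its card. -/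
theorem List.Nodup.countP_le_card {α : Type*} [DecidableEq α] {l : List α} (hl : l.Nodup)
    (p : α → Bool) (s : Finset α) (h : ∀ x ∈ l, p x = true → x ∈ s) : l.countP p ≤ s.card := by
  rw [List.countP_eq_length_filter, ← List.toFinset_card_of_nodup (hl.filter _)]
  refine Finset.card_le_card fun x hx => ?_
  rw [List.mem_toFinset, List.mem_filter] at hx
  exact h x hx.1 hx.2

/-- A relation on a large finite type in which every element misses at most `d` out-neighbours
and at most `d` in-neighbours has a spanning directed path from any `s` to any `t ≠ s`. -/
theorem exists_spanning_isChain {β : Type*} [Fintype β] (R : β → β → Prop)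
    {s t : β} (hst : s ≠ t) {d : ℕ} (hcard : 4 * d + 3 ≤ Fintype.card β)
    (hout : ∀ b ≠ t, {c | c ≠ s ∧ c ≠ b ∧ ¬ R b c}.ncard ≤ d)
    (hin : ∀ c ≠ s, {b | b ≠ t ∧ b ≠ c ∧ ¬ R b c}.ncard ≤ d) :
    ∃ L : List β, L.Nodup ∧ (∀ b, b ∈ L) ∧ L.IsChain R := by
  classical
  have hout' : ∀ b ≠ t, (Finset.univ.filter fun c => c ≠ s ∧ c ≠ b ∧ ¬ R b c).card ≤ d := by
    intro b hb
    have := hout b hb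
    rwa [Set.ncard_eq_toFinset_card', Set.toFinset_ofPred] at this
  have hin' : ∀ c ≠ s, (Finset.univ.filter fun b => b ≠ t ∧ b ≠ c ∧ ¬ R b c).card ≤ d := by
    intro c hc
    have := hin c hc
    rwa [Set.ncard_eq_toFinset_card', Set.toFinset_ofPred] at this
  -- few vertices fail to fit between two given ones
  have common : ∀ x y, x ≠ t → y ≠ s → ∀ L : List β, s ∈ L → t ∈ L → x ∈ L → y ∈ L →
      L.length + 2 * d < Fintype.card β → ∃ w, w ∉ L ∧ R x w ∧ R w y := by
    intro x y hx hy L hs ht hxL hyL hlen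
    by_contra! hno
    have hsub : (Finset.univ : Finset β) ⊆ L.toFinset ∪
        ((Finset.univ.filter fun c => c ≠ s ∧ c ≠ x ∧ ¬ R x c) ∪
          (Finset.univ.filter fun b => b ≠ t ∧ b ≠ y ∧ ¬ R b y)) := by
      intro w _
      by_cases hw : w ∈ L
      · simp [hw]
      · have h1 : w ≠ s := fun h => hw (h ▸ hs)
        have h2 : w ≠ t := fun h => hw (h ▸ ht)
        have h3 : w ≠ x := fun h => hw (h ▸ hxL)
        have h4 : w ≠ y := fun h => hw (h ▸ hyL)
        have := hno w hw
        simp only [Finset.mem_union, Finset.mem_filter, Finset.mem_univ, true_and]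
        tauto
    have h1 := Finset.card_le_card hsub
    have h2 := Finset.card_union_le L.toFinset
      ((Finset.univ.filter fun c => c ≠ s ∧ c ≠ x ∧ ¬ R x c) ∪
          (Finset.univ.filter fun b => b ≠ t ∧ b ≠ y ∧ ¬ R b y))
    have h3 := Finset.card_union_le (Finset.univ.filter fun c => c ≠ s ∧ c ≠ x ∧ ¬ R x c)
          (Finset.univ.filter fun b => b ≠ t ∧ b ≠ y ∧ ¬ R b y)
    have h4 := List.toFinset_card_le L
    have h5 := hout' x hx
    have h6 := hin' y hy
    rw [Finset.card_univ] at h1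
    omega
  have grow : ∀ m, m + 3 ≤ Fintype.card β → ∃ M : List β, M.length = m + 1 ∧
      (s :: (M ++ [t])).Nodup ∧ (s :: (M ++ [t])).IsChain R := by
    intro m
    induction m with
    | zero =>
      intro _
      obtain ⟨w, hw, h1, h2⟩ := common s t hst hst.symm [s, t] (by simp) (by simp) (by simp)
        (by simp) (by simp; omega)
      refine ⟨[w], rfl, ?_, ?_⟩
      · simp at hw ⊢
        exact ⟨⟨Ne.symm hw.1, hst⟩, hw.2⟩
      · simp [h1, h2]
    | succ m ih =>
      intro hm
      obtain ⟨M, hlen, hnd, hch⟩ := ih (by omega)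
      have hinsert : ∃ w l₁ x y l₂, w ∉ s :: (M ++ [t]) ∧
          s :: (M ++ [t]) = l₁ ++ x :: y :: l₂ ∧ R x w ∧ R w y := by
        by_cases hshort : (s :: (M ++ [t])).length + 2 * d < Fintype.card β
        · obtain ⟨y, M', rfl⟩ : ∃ y M', M = y :: M' := by
            cases M with
            | nil => simp at hlen
            | cons y M' => exact ⟨y, M', rfl⟩
          have hys : y ≠ s := by
            rintro rfl
            simp at hnd
          obtain ⟨w, hw, h1, h2⟩ := common s y hst hys _ (by simp) (by simp) (by simp)
            (by simp) hshort
          exact ⟨w, [], s, y, M' ++ [t], hw, by simp, h1, h2⟩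
        · obtain ⟨w, hw⟩ : ∃ w, w ∉ s :: (M ++ [t]) := by
            by_contra! hall
            have : (Finset.univ : Finset β) ⊆ (s :: (M ++ [t])).toFinset := fun w _ => by
              exact List.mem_toFinset.2 (hall w)
            have h1 := Finset.card_le_card this
            have h2 := List.toFinset_card_le (s :: (M ++ [t]))
            rw [Finset.card_univ] at h1
            simp at h2
            simp at h1
            omega
          have hws : w ≠ s := fun h => hw (by simp [h])
          have hwt : w ≠ t := fun h => hw (by simp [h])
          rcases List.exists_consecutive_or_length_le_countP (fun x => R x w) (fun y => R w y)
            s (M ++ [t]) with ⟨l₁, x, y, l₂, h, hx, hy⟩ | h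
          · exact ⟨w, l₁, x, y, l₂, hw, h, hx, hy⟩
          · exfalso
            have e : (s :: (M ++ [t])).dropLast = s :: M := by
              rw [← List.cons_append, List.dropLast_concat]
            rw [e] at h
            have hnd' : (s :: M).Nodup ∧ t ∉ s :: M := by
              rw [← List.cons_append, List.nodup_append] at hnd
              exact ⟨hnd.1, fun ht => hnd.2.2 t ht t (by simp) rfl⟩
            have h1 := (hnd'.1.countP_le_card (fun x => ¬ R x w) _ (by
              intro x hx hxw
              rw [Finset.mem_filter]
              refine ⟨Finset.mem_univ _, ?_, ?_, by simpa using hxw⟩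
              · rintro rfl; exact hnd'.2 hx
              · rintro rfl; exact hw (by simp at hx ⊢; tauto))).trans (hin' w hws)
            have h2 := ((List.nodup_cons.1 hnd).2.countP_le_card (fun x => ¬ R w x) _ (by
              intro x hx hxw
              rw [Finset.mem_filter]
              refine ⟨Finset.mem_univ _, ?_, ?_, by simpa using hxw⟩
              · rintro rfl; exact (List.nodup_cons.1 hnd).1 hx
              · rintro rfl; exact hw (by simp at hx ⊢; tauto))).trans (hout' w hwt)
            simp at hshort h
            simp at h1 h2
            omega
      obtain ⟨w, l₁, x, y, l₂, hw, he, h1, h2⟩ := hinsert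
      -- the insertion keeps the first and the last entry
      have hnew : ∃ M' : List β, l₁ ++ x :: w :: y :: l₂ = s :: (M' ++ [t]) := by
        obtain ⟨u, hu⟩ : ∃ u, l₁ ++ [x] = s :: u := by
          cases l₁ with
          | nil => simp at he; exact ⟨[], by simp [he.1]⟩
          | cons a l => simp at he; exact ⟨l ++ [x], by simp [he.1]⟩
        obtain ⟨v, hv⟩ : ∃ v, y :: l₂ = v ++ [t] := by
          rcases List.eq_nil_or_concat (y :: l₂) with h | ⟨v, z, h⟩
          · simp at h
          · refine ⟨v, ?_⟩
            have := congrArg List.getLast? he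
            rw [← List.cons_append, List.getLast?_concat,
              show l₁ ++ x :: y :: l₂ = (l₁ ++ x :: v) ++ [z] by simp [h],
              List.getLast?_concat] at this
            rw [h]
            simp at this
            simp [this]
        refine ⟨u ++ w :: v, ?_⟩
        calc l₁ ++ x :: w :: y :: l₂ = (l₁ ++ [x]) ++ w :: (y :: l₂) := by simp
          _ = s :: (u ++ w :: v ++ [t]) := by rw [hu, hv]; simp
      obtain ⟨M', hM'⟩ := hnew
      have hperm : (s :: (M' ++ [t])).Perm (w :: (s :: (M ++ [t]))) := by
        rw [← hM', he]
        have := @List.perm_middle _ w (l₁ ++ [x]) (y :: l₂)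
        simpa using this
      refine ⟨M', ?_, ?_, ?_⟩
      · have := hperm.length_eq
        simp at this
        omega
      · rw [hperm.nodup_iff, List.nodup_cons]
        exact ⟨hw, hnd⟩
      · rw [← hM']
        rw [he, List.isChain_split, List.isChain_cons_cons] at hch
        rw [List.isChain_split, List.isChain_cons_cons, List.isChain_cons_cons]
        exact ⟨hch.1, h1, h2, hch.2.2⟩
  obtain ⟨M, hlen, hnd, hch⟩ := grow (Fintype.card β - 3) (by omega)
  refine ⟨_, hnd, fun b => ?_, hch⟩
  have : (s :: (M ++ [t])).toFinset = Finset.univ := by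
    apply Finset.eq_univ_of_card
    rw [List.toFinset_card_of_nodup hnd]
    simp
    omega
  rw [← List.mem_toFinset, this]
  exact Finset.mem_univ b

/-- In a finite acyclic graph of maximum degree at most two, the connected component of any vertex
is spanned by a path, both ends of which have degree at most one. -/
theorem SimpleGraph.IsAcyclic.exists_isPath_support_eq_component {V : Type*} [Finite V]
    {F : SimpleGraph V} (hF : F.IsAcyclic) (hdeg : ∀ v, (F.neighborSet v).ncard ≤ 2) (v : V) :
    ∃ (a b : V) (q : F.Walk a b), q.IsPath ∧ (∀ x, x ∈ q.support ↔ F.Reachable v x) ∧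
      (F.neighborSet a).ncard ≤ 1 ∧ (F.neighborSet b).ncard ≤ 1 := by
  classical
  have := Fintype.ofFinite V
  let Q : ℕ → Prop := fun n => ∃ (a b : V) (q : F.Walk a b), q.IsPath ∧ F.Reachable v a ∧
    q.length = n
  have hQ0 : Q 0 := ⟨v, v, .nil, .nil, .rfl, rfl⟩
  have hQle : ∀ n, Q n → n ≤ Fintype.card V := by
    rintro n ⟨a, b, q, hq, -, rfl⟩
    exact hq.length_lt.le
  obtain ⟨a, b, q, hq, hva, hlen⟩ : Q (Nat.findGreatest Q (Fintype.card V)) :=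
    Nat.findGreatest_spec (Nat.zero_le _) hQ0
  have hmax : ∀ (a' b' : V) (q' : F.Walk a' b'), q'.IsPath → F.Reachable v a' →
      q'.length ≤ q.length := by
    intro a' b' q' hq' hr
    rw [hlen]
    exact Nat.le_findGreatest (hQle _ ⟨a', b', q', hq', hr, rfl⟩) ⟨a', b', q', hq', hr, rfl⟩
  have ha : ∀ x, F.Adj a x → x ∈ q.support := by
    intro x hx
    by_contra hxq
    have := hmax x b (.cons hx.symm q) (hq.cons hxq) (hva.trans hx.reachable)
    simp at this
  have hb : ∀ x, F.Adj b x → x ∈ q.support := by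
    intro x hx
    by_contra hxq
    have := hmax a x (q.concat hx) (hq.concat hxq hx) hva
    simp at this
  have hclosed : ∀ x ∈ q.support, ∀ y, F.Adj x y → y ∈ q.support := by
    intro x hx y hxy
    by_cases hxa : x = a
    · exact ha y (hxa ▸ hxy)
    by_cases hxb : x = b
    · exact hb y (hxb ▸ hxy)
    obtain ⟨i, rfl, hi⟩ := Walk.mem_support_iff_exists_getVert.1 hx
    have hi0 : i ≠ 0 := by
      rintro rfl
      simp at hxa
    have hil : i < q.length := by
      refine lt_of_le_of_ne hi ?_
      rintro rfl
      simp at hxb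
    have h2 := hq.ncard_neighborSet_toSubgraph_internal_eq_two hi0 hil
    have heq := Set.eq_of_subset_of_ncard_le (q.toSubgraph.neighborSet_subset (q.getVert i))
      ((hdeg _).trans h2.ge) (Set.toFinite _)
    have : y ∈ q.toSubgraph.neighborSet (q.getVert i) := heq ▸ hxy
    exact (Walk.mem_verts_toSubgraph q).1 (q.toSubgraph.edge_vert (this.symm))
  refine ⟨a, b, q, hq, fun x => ⟨fun hx => hva.trans (q.takeUntil x hx).reachable, ?_⟩, ?_, ?_⟩
  · intro hx
    obtain ⟨w⟩ := hva.symm.trans hx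
    have : ∀ (u u' : V) (w : F.Walk u u'), u ∈ q.support → u' ∈ q.support := by
      intro u u' w
      induction w with
      | nil => exact id
      | cons h _ ih => exact fun hu => ih (hclosed _ hu _ h)
    exact this _ _ w q.start_mem_support
  · have : F.neighborSet a ⊆ {q.snd} := fun x hx => hF.eq_snd_of_adj_start hq hx (ha x hx)
    simpa using Set.ncard_le_ncard this
  · have : F.neighborSet b ⊆ {q.penultimate} := fun x hx =>
      hF.eq_penultimate_of_adj_end hq hx (hb x hx)
    simpa using Set.ncard_le_ncard this

/-- Suppose `F ≤ G` is a linear forest on `S ⊇ H` without edges inside `H`, that at most two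
vertices `Z` of `S \ H` are leaves of `F`, and that these lie in distinct components. If `H` is
large and almost complete in `G`, then `G` has a path with at least `S.card` vertices. -/
theorem exists_isPath_card_le_of_linearForest {V : Type*} [Finite V] {G F : SimpleGraph V}
    (hFG : F ≤ G) (hF : F.IsAcyclic) (hdeg : ∀ v, (F.neighborSet v).ncard ≤ 2)
    [DecidableEq V] {H S Z : Finset V} (hHS : H ⊆ S) (hS : ∀ x y, F.Adj x y → x ∈ S)
    (hHH : ∀ x y, F.Adj x y → ¬ (x ∈ H ∧ y ∈ H))
    (hZ : ∀ z ∈ S, z ∉ H → (F.neighborSet z).ncard ≤ 1 → z ∈ Z) (hZcard : Z.card ≤ 2)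
    (hZreach : ∀ z ∈ Z, ∀ z' ∈ Z, F.Reachable z z' → z = z')
    (hZadj : ∀ z ∈ Z, ∃ y, F.Adj z y) {d : ℕ}
    (hnon : ∀ x ∈ H, {y | y ∈ H ∧ y ≠ x ∧ ¬ G.Adj x y}.ncard ≤ d)
    (hcard : 4 * d + 3 + (S \ H).card ≤ H.card) :
    ∃ (u v : V) (q : G.Walk u v), q.IsPath ∧ S.card ≤ q.support.length := by
  classical
  have := Fintype.ofFinite V
  let mk := F.connectedComponentMk
  let β := {c : F.ConnectedComponent // c ∈ S.image mk}
  have hmk : ∀ {x y}, mk x = mk y ↔ F.Reachable x y := ConnectedComponent.eq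
  -- the component of any vertex of `S` stays in `S`
  have hreachS : ∀ x y, x ∈ S → F.Reachable x y → y ∈ S := by
    rintro x y hx ⟨w⟩
    induction w with
    | nil => exact hx
    | cons h _ ih => exact ih (hS _ _ h.symm)
  -- an unoriented block for each component
  have hblock : ∀ c : β, ∃ (l : List V) (a b : V), l.Nodup ∧ l.IsChain F.Adj ∧
      (∀ x, x ∈ l ↔ mk x = c.1) ∧ l.head? = some a ∧ l.getLast? = some b ∧
      (a ∈ H ∨ a ∈ Z) ∧ (b ∈ H ∨ b ∈ Z) := by
    rintro ⟨c, hc⟩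
    obtain ⟨v, hv, rfl⟩ := Finset.mem_image.1 hc
    obtain ⟨a, b, q, hq, hmem, ha, hb⟩ := hF.exists_isPath_support_eq_component hdeg v
    have haS := hreachS v a hv ((hmem a).1 q.start_mem_support)
    have hbS := hreachS v b hv ((hmem b).1 q.end_mem_support)
    refine ⟨q.support, a, b, hq.support_nodup, q.isChain_adj_support,
      fun x => by rw [hmem, hmk, reachable_comm], ?_, ?_, ?_, ?_⟩
    · rw [List.head?_eq_some_head q.support_ne_nil, Walk.head_support]
    · rw [List.getLast?_eq_some_getLast q.support_ne_nil, Walk.getLast_support]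
    · by_cases h : a ∈ H
      · exact Or.inl h
      · exact Or.inr (hZ a haS h ha)
    · by_cases h : b ∈ H
      · exact Or.inl h
      · exact Or.inr (hZ b hbS h hb)
  -- at most one end of a block is outside `H`
  have hend : ∀ (l : List V) (a b : V) (c : β), l.Nodup → (∀ x, x ∈ l ↔ mk x = c.1) →
      l.head? = some a → l.getLast? = some b → a ∈ Z → b ∈ Z → False := by
    intro l a b c hnd hmem hla hlb ha hb
    have hal := List.mem_of_mem_head? hla
    have hbl := List.mem_of_mem_getLast? hlb
    have hab : a = b := hZreach a ha b hb (hmk.1 (((hmem a).1 hal).trans ((hmem b).1 hbl).symm))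
    obtain ⟨y, hy⟩ := hZadj a ha
    have hyl : y ∈ l := (hmem y).2 ((hmk.2 hy.symm.reachable).trans ((hmem a).1 hal))
    cases l with
    | nil => simp at hal
    | cons z l =>
      simp at hla
      cases l with
      | nil =>
        simp at hyl
        exact hy.ne (hla.symm.trans hyl.symm)
      | cons z' l =>
        rw [List.getLast?_cons_cons] at hlb
        have := List.mem_of_mem_getLast? hlb
        rw [List.nodup_cons] at hnd
        exact hnd.1 (hla ▸ hab ▸ this)
  -- counting the components
  have hβ : H.card ≤ (S \ H).card + Fintype.card β := by
    have h1 : H.card = ∑ c ∈ S.image mk, (H.filter fun x => mk x = c).card :=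
      Finset.card_eq_sum_card_fiberwise fun x hx => Finset.mem_image_of_mem mk (hHS hx)
    have h2 : (S \ H).card = ∑ c ∈ S.image mk, ((S \ H).filter fun x => mk x = c).card :=
      Finset.card_eq_sum_card_fiberwise fun x hx =>
        Finset.mem_image_of_mem mk (Finset.sdiff_subset hx)
    have h3 : Fintype.card β = ∑ _c ∈ S.image mk, 1 := by
      rw [Finset.sum_const, smul_eq_mul, mul_one]
      exact Fintype.card_coe _
    rw [h1, h2, h3, ← Finset.sum_add_distrib]
    refine Finset.sum_le_sum fun c hc => ?_
    obtain ⟨l, a, b, hnd, hch, hmem, -⟩ := hblock ⟨c, hc⟩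
    have hle := (hch.imp fun x y h => hHH x y h).countP_le_countP_not_add_one (· ∈ H)
    have hge : (H.filter fun x => mk x = c).card ≤ l.countP (fun x => x ∈ H) := by
      rw [List.countP_eq_length_filter]
      refine le_trans (Finset.card_le_card fun x hx => ?_) (List.toFinset_card_le _)
      rw [Finset.mem_filter] at hx
      rw [List.mem_toFinset, List.mem_filter, hmem]
      exact ⟨hx.2, by simpa using hx.1⟩
    have hle' := hnd.countP_le_card (fun x => ¬ x ∈ H) ((S \ H).filter fun x => mk x = c) (by
      intro x hx hxH
      have hxc := (hmem x).1 hx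
      obtain ⟨v, hv, hvc⟩ := Finset.mem_image.1 hc
      rw [Finset.mem_filter, Finset.mem_sdiff]
      exact ⟨⟨hreachS v x hv (hmk.1 (hvc.trans hxc.symm)), by simpa using hxH⟩, hxc⟩)
    omega
  -- the first and the last component
  obtain ⟨s, t, hst, hZst⟩ : ∃ s t : β, s ≠ t ∧ ∀ z ∈ Z, mk z = s.1 ∨ mk z = t.1 := by
    let T : Finset β := Finset.univ.filter fun c => ∃ z ∈ Z, mk z = c.1
    have hT : T.card ≤ 2 := by
      have : T.image Subtype.val ⊆ Z.image mk := by
        intro c hc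
        obtain ⟨c', hc', rfl⟩ := Finset.mem_image.1 hc
        obtain ⟨z, hz, h⟩ := (Finset.mem_filter.1 hc').2
        exact h ▸ Finset.mem_image_of_mem mk hz
      have := (Finset.card_le_card this).trans Finset.card_image_le
      rw [Finset.card_image_of_injective _ Subtype.val_injective] at this
      omega
    obtain ⟨U, hTU, hU⟩ := Finset.exists_superset_card_eq hT (by omega)
    obtain ⟨s, t, hst, rfl⟩ := Finset.card_eq_two.1 hU
    refine ⟨s, t, hst, fun z hz => ?_⟩
    obtain ⟨y, hy⟩ := hZadj z hz
    have : (⟨mk z, Finset.mem_image_of_mem mk (hS z y hy)⟩ : β) ∈ T :=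
      Finset.mem_filter.2 ⟨Finset.mem_univ _, z, hz, rfl⟩
    have := hTU this
    rw [Finset.mem_insert, Finset.mem_singleton] at this
    exact this.imp (congrArg Subtype.val) (congrArg Subtype.val)
  -- oriented blocks
  have horiented : ∀ c : β, ∃ (l : List V) (a b : V), l.Nodup ∧ l.IsChain F.Adj ∧
      (∀ x, x ∈ l ↔ mk x = c.1) ∧ l.head? = some a ∧ l.getLast? = some b ∧
      (c ≠ s → a ∈ H) ∧ (c ≠ t → b ∈ H) := by
    intro c
    obtain ⟨l, a, b, hnd, hch, hmem, hla, hlb, ha, hb⟩ := hblock c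
    have hrev : l.reverse.IsChain F.Adj := by
      rw [List.isChain_reverse]
      exact hch.imp fun x y h => h.symm
    have hac : mk a = c.1 := (hmem a).1 (List.mem_of_mem_head? hla)
    have hbc : mk b = c.1 := (hmem b).1 (List.mem_of_mem_getLast? hlb)
    have hcZ : ∀ z ∈ Z, mk z = c.1 → c = s ∨ c = t := fun z hz h =>
      (hZst z hz).imp (fun h' => Subtype.ext (h.symm.trans h'))
        (fun h' => Subtype.ext (h.symm.trans h'))
    have hends := hend l a b c hnd hmem hla hlb
    have keep : (c ≠ s → a ∈ H) → (c ≠ t → b ∈ H) → _ := fun h1 h2 =>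
      (⟨l, a, b, hnd, hch, hmem, hla, hlb, h1, h2⟩ : ∃ (l : List V) (a b : V), l.Nodup ∧
        l.IsChain F.Adj ∧ (∀ x, x ∈ l ↔ mk x = c.1) ∧ l.head? = some a ∧ l.getLast? = some b ∧
        (c ≠ s → a ∈ H) ∧ (c ≠ t → b ∈ H))
    have flip : (c ≠ s → b ∈ H) → (c ≠ t → a ∈ H) → _ := fun h1 h2 =>
      (⟨l.reverse, b, a, List.nodup_reverse.2 hnd, hrev, fun x => by rw [List.mem_reverse, hmem],
        by rw [List.head?_reverse, hlb], by rw [List.getLast?_reverse, hla], h1, h2⟩ :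
        ∃ (l : List V) (a b : V), l.Nodup ∧
        l.IsChain F.Adj ∧ (∀ x, x ∈ l ↔ mk x = c.1) ∧ l.head? = some a ∧ l.getLast? = some b ∧
        (c ≠ s → a ∈ H) ∧ (c ≠ t → b ∈ H))
    by_cases haH : a ∈ H <;> by_cases hbH : b ∈ H
    · exact keep (fun _ => haH) (fun _ => hbH)
    · rcases hcZ b (hb.resolve_left hbH) hbc with rfl | rfl
      · exact flip (fun h => absurd rfl h) (fun _ => haH)
      · exact keep (fun _ => haH) (fun h => absurd rfl h)
    · rcases hcZ a (ha.resolve_left haH) hac with rfl | rfl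
      · exact keep (fun h => absurd rfl h) (fun _ => hbH)
      · exact flip (fun _ => hbH) (fun h => absurd rfl h)
    · exact (hends (ha.resolve_left haH) (hb.resolve_left hbH)).elim
  choose f hd tl hnd hch hmem hhd htl hhdH htlH using horiented
  have hhdc : ∀ c, mk (hd c) = c.1 := fun c => (hmem c _).1 (List.mem_of_mem_head? (hhd c))
  have htlc : ∀ c, mk (tl c) = c.1 := fun c => (hmem c _).1 (List.mem_of_mem_getLast? (htl c))
  obtain ⟨L, hLnd, hLmem, hLch⟩ := exists_spanning_isChain (fun b c => G.Adj (tl b) (hd c)) hst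
    (d := d) (by omega)
    (by
      intro b hb
      refine le_trans (Set.ncard_le_ncard_of_injOn hd ?_ ?_ (Set.toFinite _)) (hnon _ (htlH b hb))
      · rintro c ⟨hcs, hcb, hadj⟩
        refine ⟨hhdH c hcs, fun h => hcb (Subtype.ext ?_), hadj⟩
        rw [← hhdc c, h, htlc]
      · intro c _ c' _ h
        exact Subtype.ext (by rw [← hhdc c, h, hhdc]))
    (by
      intro c hc
      refine le_trans (Set.ncard_le_ncard_of_injOn tl ?_ ?_ (Set.toFinite _)) (hnon _ (hhdH c hc))
      · rintro b ⟨hbt, hbc, hadj⟩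
        refine ⟨htlH b hbt, fun h => hbc (Subtype.ext ?_), fun h => hadj h.symm⟩
        rw [← htlc b, h, hhdc]
      · intro c _ c' _ h
        exact Subtype.ext (by rw [← htlc c, h, htlc]))
  -- concatenate the blocks
  have hne : ∀ c, f c ≠ [] := by
    intro c h
    have := hhd c
    simp [h] at this
  have hchain : (L.map f).flatten.IsChain G.Adj := by
    rw [List.isChain_flatten (fun h => by
      obtain ⟨c, -, hc⟩ := List.mem_map.1 h
      exact hne c hc)]
    constructor
    · intro l hl
      obtain ⟨c, -, rfl⟩ := List.mem_map.1 hl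
      exact (hch c).imp fun x y h => hFG h
    · rw [List.isChain_map]
      refine hLch.imp fun b c h x hx y hy => ?_
      rw [htl, Option.mem_some_iff] at hx
      rw [hhd, Option.mem_some_iff] at hy
      exact hx ▸ hy ▸ h
  have hnodup : (L.map f).flatten.Nodup := by
    rw [List.nodup_flatten]
    constructor
    · intro l hl
      obtain ⟨c, -, rfl⟩ := List.mem_map.1 hl
      exact hnd c
    · rw [List.pairwise_map]
      refine hLnd.imp fun {b c} hbc x hx hx' => hbc (Subtype.ext ?_)
      rw [← (hmem b x).1 hx, (hmem c x).1 hx']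
  have hsub : S ⊆ (L.map f).flatten.toFinset := by
    intro x hx
    rw [List.mem_toFinset, List.mem_flatten]
    let c : β := ⟨mk x, Finset.mem_image_of_mem mk hx⟩
    exact ⟨f c, List.mem_map_of_mem (hLmem c), (hmem c x).2 rfl⟩
  have hnil : (L.map f).flatten ≠ [] := by
    intro h
    have : hd s ∈ (L.map f).flatten :=
      List.mem_flatten.2 ⟨f s, List.mem_map_of_mem (hLmem s), (hmem s _).2 (hhdc s)⟩
    simp [h] at this
  refine ⟨_, _, Walk.ofSupport _ hnil hchain, ?_, ?_⟩
  · rw [Walk.isPath_def, Walk.support_ofSupport]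
    exact hnodup
  · rw [Walk.support_ofSupport]
    exact (Finset.card_le_card hsub).trans (List.toFinset_card_le _)

section Segments

variable {V : Type*} {G : SimpleGraph V} {r : ℕ} {P : Fin r → PathIn G} {T : Set V}

theorem segUnionGraph_adj {x y : V} :
    (segUnionGraph P).Adj x y ↔ ∃ i, (P i).walk.toSubgraph.Adj x y := by
  simp [segUnionGraph]

theorem segUnionGraph_le : segUnionGraph P ≤ G :=
  fun _ _ h => (segUnionGraph_adj.1 h).elim fun _ hi => hi.adj_sub

namespace PathIn

theorem mem_verts_of_toSubgraph_adj {Q : PathIn G} {x y : V} (h : Q.walk.toSubgraph.Adj x y) :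
    x ∈ Q.verts :=
  (Walk.mem_verts_toSubgraph _).1 (Q.walk.toSubgraph.edge_vert h)

/-- An internal vertex of a path has two neighbours on the path. -/
theorem ncard_neighborSet_eq_two {Q : PathIn G} {x : V} (hx : x ∈ Q.verts)
    (hend : ¬ Q.IsEndpoint x) : (Q.walk.toSubgraph.neighborSet x).ncard = 2 := by
  obtain ⟨i, rfl, hi⟩ := Walk.mem_support_iff_exists_getVert.1 hx
  refine Q.isPath.ncard_neighborSet_toSubgraph_internal_eq_two ?_ (lt_of_le_of_ne hi ?_)
  · rintro rfl
    exact hend (Or.inl (by simp))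
  · rintro rfl
    exact hend (Or.inr (by simp))

theorem exists_adj_of_two_le_length {Q : PathIn G} (h : 2 ≤ Q.walk.support.length) {x : V}
    (hx : x ∈ Q.verts) : ∃ y, Q.walk.toSubgraph.Adj x y := by
  have hnil : ¬ Q.walk.Nil := by
    rw [← Walk.length_eq_zero_iff]
    rw [Walk.length_support] at h
    omega
  by_cases hend : Q.IsEndpoint x
  · have h1 := Q.isPath.neighborSet_toSubgraph_startpoint hnil
    have h2 := Q.isPath.neighborSet_toSubgraph_endpoint hnil
    rcases hend with rfl | rfl
    · exact ⟨_, (Set.ext_iff.1 h1 _).2 rfl⟩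
    · exact ⟨_, (Set.ext_iff.1 h2 _).2 rfl⟩
  · obtain ⟨y, hy⟩ := Set.nonempty_of_ncard_ne_zero
      (by rw [ncard_neighborSet_eq_two hx hend]; decide :
        (Q.walk.toSubgraph.neighborSet x).ncard ≠ 0)
    exact ⟨y, hy⟩

theorem isEndpoint_or_mem_internals {Q : PathIn G} {x : V} (hx : x ∈ Q.verts) :
    Q.IsEndpoint x ∨ x ∈ Q.internals := by
  obtain ⟨a, b, q, hq⟩ := Q
  change x ∈ q.support at hx
  change (x = a ∨ x = b) ∨ x ∈ q.support.tail.dropLast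
  by_cases hxb : x = b
  · exact Or.inl (Or.inr hxb)
  rw [Walk.mem_support_iff] at hx
  rcases hx with rfl | hx
  · exact Or.inl (Or.inl rfl)
  · right
    have hne := List.ne_nil_of_mem hx
    rw [← List.dropLast_append_getLast hne, List.mem_append, List.mem_singleton,
      List.getLast_tail, Walk.getLast_support] at hx
    exact hx.resolve_right hxb

end PathIn

theorem IsOneTerminalSegment.eq_of_mem {Q : PathIn G} (hQ : IsOneTerminalSegment G T Q) {x y : V}
    (hx : x ∈ Q.verts) (hy : y ∈ Q.verts) (hxT : x ∈ T) (hyT : y ∈ T) : x = y := by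
  obtain ⟨a, b, q, hq⟩ := Q
  change x ∈ q.support at hx
  change y ∈ q.support at hy
  rcases hQ.2 with ⟨-, h⟩ | ⟨-, h⟩
  · rw [Walk.mem_support_iff] at hx hy
    rw [hx.resolve_right fun hx => h x hx hxT, hy.resolve_right fun hy => h y hy hyT]
  · change ∀ x ∈ q.support.dropLast, x ∉ T at h
    rw [← List.dropLast_append_getLast q.support_ne_nil, List.mem_append, List.mem_singleton,
      Walk.getLast_support] at hx hy
    rw [hx.resolve_left fun hx => h x hx hxT, hy.resolve_left fun hy => h y hy hyT]

theorem IsOneTerminalSegment.eq_of_isEndpoint {Q : PathIn G} (hQ : IsOneTerminalSegment G T Q)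
    {x y : V} (hx : Q.IsEndpoint x) (hy : Q.IsEndpoint y) (hxT : x ∉ T) (hyT : y ∉ T) :
    x = y := by
  unfold PathIn.IsEndpoint at hx hy
  rcases hQ.2 with ⟨h, -⟩ | ⟨h, -⟩
  · rw [hx.resolve_left fun e => hxT (e ▸ h), hy.resolve_left fun e => hyT (e ▸ h)]
  · rw [hx.resolve_right fun e => hxT (e ▸ h), hy.resolve_right fun e => hyT (e ▸ h)]

theorem IsTwoTerminalSegment.not_adj {Q : PathIn G} (hQ : IsTwoTerminalSegment G T Q)
    {x y : V} (hxT : x ∈ T) (hyT : y ∈ T) : ¬ Q.walk.toSubgraph.Adj x y := by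
  intro h
  have hx := (PathIn.isEndpoint_or_mem_internals
    (PathIn.mem_verts_of_toSubgraph_adj h)).resolve_right fun hi => hQ.2.2.2 x hi hxT
  have hy := (PathIn.isEndpoint_or_mem_internals
    (PathIn.mem_verts_of_toSubgraph_adj h.symm)).resolve_right fun hi => hQ.2.2.2 y hi hyT
  have hlen : ¬ s(Q.first, Q.last) ∈ Q.walk.edges := by
    intro he
    have h1 := Q.isPath.length_eq_one_of_mem_edges he
    have h2 := hQ.1
    rw [Walk.length_support] at h2
    omega
  have he := Walk.adj_toSubgraph_iff_mem_edges.1 h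
  rcases hx with rfl | rfl <;> rcases hy with rfl | rfl
  · exact h.ne rfl
  · exact hlen he
  · exact hlen (Sym2.eq_swap ▸ he)
  · exact h.ne rfl

end Segments

/-- Let `k ≥ 1` and let `H` be (the vertex set of) an induced subgraph of `G` with
`δ(H) ≥ max {5k - 3, |V(H)| - k}`. If `G` has an extended system of `V(H)`-segments
whose total number of vertices outside `V(H)` equals `p`, where `p ≤ k - 1`, then `G`
contains a path with at least `|V(H)| + p` vertices. -/
theorem path_of_extendedSegmentSystem {V : Type*} [Fintype V] (G : SimpleGraph V)
    (k p r : ℕ) (hk : 1 ≤ k) (hpk : p ≤ k - 1) (H : Set V)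
    (hδ : ∀ v ∈ H, max (5 * k - 3) (H.ncard - k) ≤ (G.neighborSet v ∩ H).ncard)
    (P : Fin r → PathIn G) (hsys : IsExtendedSegmentSystem G H P)
    (hp : outsideCount H P = p) :
    ∃ (u v : V) (q : G.Walk u v), q.IsPath ∧ H.ncard + p ≤ q.support.length := by
  classical
  obtain ⟨⟨i₀, hi₀⟩, hthree, hall, -, -, ⟨hac, hdeg⟩, hsep⟩ := hsys
  -- a vertex of `H` misses few others
  have hsub : ∀ v ∈ H, G.neighborSet v ∩ H ⊆ H \ {v} := fun v _ y hy =>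
    ⟨hy.2, fun h => G.ne_of_adj hy.1 (Set.mem_singleton_iff.1 h).symm⟩
  have hcardH : 5 * k - 2 ≤ H.ncard := by
    obtain ⟨v, hv⟩ : H.Nonempty := by
      rcases hi₀.2 with h | h
      exacts [⟨_, h.1⟩, ⟨_, h.1⟩]
    have h1 := Set.ncard_le_ncard (hsub v hv)
    have h2 := Set.ncard_sdiff_singleton_add_one hv
    have h3 := (le_max_left _ _).trans (hδ v hv)
    omega
  have hnon : ∀ x ∈ H, {y | y ∈ H ∧ y ≠ x ∧ ¬ G.Adj x y}.ncard ≤ k - 1 := by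
    intro x hx
    have h1 : {y | y ∈ H ∧ y ≠ x ∧ ¬ G.Adj x y} ⊆ (H \ {x}) \ (G.neighborSet x ∩ H) :=
      fun y hy => ⟨⟨hy.1, hy.2.1⟩, fun h => hy.2.2 h.1⟩
    have h2 := Set.ncard_le_ncard h1
    rw [Set.ncard_sdiff (hsub x hx)] at h2
    have h3 := Set.ncard_sdiff_singleton_add_one hx
    have h4 := (le_max_right _ _).trans (hδ x hx)
    omega
  -- leaves outside `H` are ends of one-terminal segments
  have hlen : ∀ i, 2 ≤ (P i).walk.support.length := fun i =>
    (hall i).elim (fun h => h.1) fun h => le_trans (by norm_num) h.1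
  have hleaf : ∀ z ∈ ⋃ i, (P i).verts, z ∉ H → ((segUnionGraph P).neighborSet z).ncard ≤ 1 →
      ∃ i, IsOneTerminalSegment G H (P i) ∧ z ∈ (P i).verts ∧ (P i).IsEndpoint z := by
    intro z hz hzH hz1
    obtain ⟨i, hi⟩ := Set.mem_iUnion.1 hz
    have hend : (P i).IsEndpoint z := by
      by_contra hend
      have h1 := PathIn.ncard_neighborSet_eq_two hi hend
      have h2 : (P i).walk.toSubgraph.neighborSet z ⊆ (segUnionGraph P).neighborSet z :=
        fun y hy => segUnionGraph_adj.2 ⟨i, hy⟩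
      have := Set.ncard_le_ncard h2
      omega
    refine ⟨i, (hall i).resolve_right fun h => ?_, hi, hend⟩
    rcases hend with rfl | rfl
    · exact hzH h.2.1
    · exact hzH h.2.2.1
  let S : Finset V := ((⋃ i, (P i).verts) ∪ H).toFinset
  let Z : Finset V := S.filter fun z => z ∉ H ∧ ((segUnionGraph P).neighborSet z).ncard ≤ 1
  have hZ : ∀ z ∈ Z, z ∈ (⋃ i, (P i).verts) ∧ z ∉ H ∧
      ((segUnionGraph P).neighborSet z).ncard ≤ 1 := by
    intro z hz
    obtain ⟨h1, h2, h3⟩ := Finset.mem_filter.1 hz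
    exact ⟨(Set.mem_toFinset.1 h1).resolve_right h2, h2, h3⟩
  have hZleaf : ∀ z ∈ Z,
      ∃ i, IsOneTerminalSegment G H (P i) ∧ z ∈ (P i).verts ∧ (P i).IsEndpoint z :=
    fun z hz => hleaf z (hZ z hz).1 (hZ z hz).2.1 (hZ z hz).2.2
  have hdiff : S \ H.toFinset = ((⋃ i, (P i).verts) \ H).toFinset := by
    ext x
    simp [S]
    tauto
  have hScard : (S \ H.toFinset).card = p := by
    rw [hdiff, ← hp, outsideCount, Set.ncard_eq_toFinset_card']
  have hHcard : H.toFinset.card = H.ncard := (Set.ncard_eq_toFinset_card' H).symm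
  have hHS : H.toFinset ⊆ S := fun x hx =>
    Set.mem_toFinset.2 (Or.inr (Set.mem_toFinset.1 hx))
  obtain ⟨u, v, q, hq, hle⟩ := exists_isPath_card_le_of_linearForest (G := G)
    (H := H.toFinset) (S := S) (Z := Z) (d := k - 1) segUnionGraph_le hac hdeg hHS
    (by
      intro x y h
      obtain ⟨i, hi⟩ := segUnionGraph_adj.1 h
      exact Set.mem_toFinset.2
        (Or.inl (Set.mem_iUnion.2 ⟨i, PathIn.mem_verts_of_toSubgraph_adj hi⟩)))
    (by
      rintro x y h ⟨hx, hy⟩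
      rw [Set.mem_toFinset] at hx hy
      obtain ⟨i, hi⟩ := segUnionGraph_adj.1 h
      rcases hall i with h1 | h2
      · exact h.ne (h1.eq_of_mem (PathIn.mem_verts_of_toSubgraph_adj hi)
          (PathIn.mem_verts_of_toSubgraph_adj hi.symm) hx hy)
      · exact h2.not_adj hx hy hi)
    (fun z hzS hzH hz => Finset.mem_filter.2
      ⟨hzS, fun h => hzH (Set.mem_toFinset.2 h), hz⟩)
    (by
      by_contra! hcard
      obtain ⟨a, b, c, ha, hb, hc, hab, hac, hbc⟩ := Finset.two_lt_card_iff.1 hcard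
      obtain ⟨i, hi, -, hia⟩ := hZleaf a ha
      obtain ⟨j, hj, -, hjb⟩ := hZleaf b hb
      obtain ⟨l, hl, -, hlc⟩ := hZleaf c hc
      rcases hthree i j l hi hj hl with rfl | rfl | rfl
      · exact hab (hi.eq_of_isEndpoint hia hjb (hZ a ha).2.1 (hZ b hb).2.1)
      · exact hac (hi.eq_of_isEndpoint hia hlc (hZ a ha).2.1 (hZ c hc).2.1)
      · exact hbc (hj.eq_of_isEndpoint hjb hlc (hZ b hb).2.1 (hZ c hc).2.1))
    (by
      intro z hz z' hz' hr
      obtain ⟨i, hi, hzi, hiz⟩ := hZleaf z hz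
      obtain ⟨j, hj, hzj, hjz⟩ := hZleaf z' hz'
      by_cases hij : i = j
      · subst hij
        exact hi.eq_of_isEndpoint hiz hjz (hZ z hz).2.1 (hZ z' hz').2.1
      · exact (hsep i j hij hi hj z hzi z' hzj hr).elim)
    (by
      intro z hz
      obtain ⟨i, -, hi, -⟩ := hZleaf z hz
      obtain ⟨y, hy⟩ := PathIn.exists_adj_of_two_le_length (hlen i) hi
      exact ⟨y, segUnionGraph_adj.2 ⟨i, hy⟩⟩)
    (fun x hx => by simpa using hnon x (Set.mem_toFinset.1 hx))
    (by rw [hScard, hHcard]; omega)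
  refine ⟨u, v, q, hq, le_trans ?_ hle⟩
  rw [← Finset.card_sdiff_add_card_eq_card hHS, hScard, hHcard, add_comm]
end

section
/- Let 0 < ε < 1 be a real number and let G be a graph on n ≥ 2 vertices. Set p = 2⌈n/ε⌉ and q = ⌈(1+ε)(p−1)⌉ − (n+p). Let G' be the graph obtained from a copy of G by adding: p new pairwise adjacent vertices u_1,…,u_p; edges v u_1 and v u_2 for every vertex v of G; and q new vertices w_1,…,w_q with the edges u_2 w_1, w_{i−1} w_i for 2 ≤ i ≤ q, and w_q u_3. Then q ≥ 1, G' is 2-connected, the degeneracy of G' equals p−1, G' has exactly ⌈(1+ε)(p−1)⌉ vertices, and G' contains a cycle with at least (1+ε)·dg(G') vertices if and only if G has a Hamiltonian path. -/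
/-- The degeneracy of a finite simple graph: the maximum, over all nonempty
(induced) subgraphs given by a vertex set `s`, of the minimum degree inside `s`. -/
noncomputable def SimpleGraph.degeneracy {V : Type*} [Fintype V] (G : SimpleGraph V) : ℕ :=
  sSup {d : ℕ | ∃ s : Set V, s.Nonempty ∧ ∀ v ∈ s, d ≤ (G.neighborSet v ∩ s).ncard}

/-- The graph `G'` of the hardness reduction for cycles: a copy of `G`, plus `p`
pairwise adjacent vertices `u_1, …, u_p` (here `u_i` is `Sum.inr (Sum.inl i)`,
with `u_1, u_2, u_3` having indices `0, 1, 2`), edges `v u_1` and `v u_2` for every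
vertex `v` of `G`, and a path `w_1, …, w_q` of new vertices (`w_i` is
`Sum.inr (Sum.inr i)`) with edges `u_2 w_1` and `w_q u_3`. -/
def cycleHardnessGraph {V : Type*} (G : SimpleGraph V) (p q : ℕ) :
    SimpleGraph (V ⊕ (Fin p ⊕ Fin q)) :=
  SimpleGraph.fromRel (fun x y =>
    match x, y with
    | Sum.inl a, Sum.inl b => G.Adj a b
    | Sum.inl _, Sum.inr (Sum.inl i) => i.val ≤ 1
    | Sum.inr (Sum.inl _), Sum.inr (Sum.inl _) => True
    | Sum.inr (Sum.inl i), Sum.inr (Sum.inr j) =>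
        (i.val = 1 ∧ j.val = 0) ∨ (i.val = 2 ∧ j.val = q - 1)
    | Sum.inr (Sum.inr i), Sum.inr (Sum.inr j) => j.val = i.val + 1
    | _, _ => False)

namespace cycleHardnessGraph

variable {V : Type*} {G : SimpleGraph V} {p q : ℕ}

@[simp]
lemma adj_inl_inl {a b : V} :
    (cycleHardnessGraph G p q).Adj (Sum.inl a) (Sum.inl b) ↔ G.Adj a b := by
  simp only [cycleHardnessGraph, SimpleGraph.fromRel_adj, G.adj_comm b a, or_self]
  exact ⟨fun h => h.2, fun h => ⟨fun e => h.ne (Sum.inl_injective e), h⟩⟩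

@[simp]
lemma adj_inl_clique {a : V} {i : Fin p} :
    (cycleHardnessGraph G p q).Adj (Sum.inl a) (Sum.inr (Sum.inl i)) ↔ i.val ≤ 1 := by
  simp [cycleHardnessGraph]

@[simp]
lemma adj_clique_inl {a : V} {i : Fin p} :
    (cycleHardnessGraph G p q).Adj (Sum.inr (Sum.inl i)) (Sum.inl a) ↔ i.val ≤ 1 := by
  simp [cycleHardnessGraph]

@[simp]
lemma not_adj_inl_path {a : V} {j : Fin q} :
    ¬ (cycleHardnessGraph G p q).Adj (Sum.inl a) (Sum.inr (Sum.inr j)) := by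
  simp [cycleHardnessGraph]

@[simp]
lemma not_adj_path_inl {a : V} {j : Fin q} :
    ¬ (cycleHardnessGraph G p q).Adj (Sum.inr (Sum.inr j)) (Sum.inl a) := by
  simp [cycleHardnessGraph]

@[simp]
lemma adj_clique_clique {i j : Fin p} :
    (cycleHardnessGraph G p q).Adj (Sum.inr (Sum.inl i)) (Sum.inr (Sum.inl j)) ↔ i ≠ j := by
  simp [cycleHardnessGraph]

@[simp]
lemma adj_clique_path {i : Fin p} {j : Fin q} :
    (cycleHardnessGraph G p q).Adj (Sum.inr (Sum.inl i)) (Sum.inr (Sum.inr j)) ↔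
      (i.val = 1 ∧ j.val = 0) ∨ (i.val = 2 ∧ j.val = q - 1) := by
  simp [cycleHardnessGraph]

@[simp]
lemma adj_path_clique {i : Fin p} {j : Fin q} :
    (cycleHardnessGraph G p q).Adj (Sum.inr (Sum.inr j)) (Sum.inr (Sum.inl i)) ↔
      (i.val = 1 ∧ j.val = 0) ∨ (i.val = 2 ∧ j.val = q - 1) := by
  simp [cycleHardnessGraph]

@[simp]
lemma adj_path_path {i j : Fin q} :
    (cycleHardnessGraph G p q).Adj (Sum.inr (Sum.inr i)) (Sum.inr (Sum.inr j)) ↔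
      j.val = i.val + 1 ∨ i.val = j.val + 1 := by
  simp only [cycleHardnessGraph, SimpleGraph.fromRel_adj, and_iff_right_iff_imp]
  intro h e
  simp only [Sum.inr.injEq] at e
  subst e
  omega

/-! ### Connectivity -/

lemma exists_clique_reachable (hp : 3 ≤ p) (v x : V ⊕ (Fin p ⊕ Fin q)) (hx : x ≠ v) :
    ∃ (i : Fin p) (hi : (Sum.inr (Sum.inl i) : V ⊕ (Fin p ⊕ Fin q)) ≠ v),
      ((cycleHardnessGraph G p q).induce ({v}ᶜ : Set (V ⊕ (Fin p ⊕ Fin q)))).Reachable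
        ⟨x, hx⟩ ⟨Sum.inr (Sum.inl i), hi⟩ := by
  rcases x with a | i | j
  · by_cases h : (Sum.inr (Sum.inl ⟨0, by omega⟩) : V ⊕ (Fin p ⊕ Fin q)) = v
    · exact ⟨⟨1, by omega⟩, by simp [← h], SimpleGraph.Adj.reachable (by simp)⟩
    · exact ⟨⟨0, by omega⟩, h, SimpleGraph.Adj.reachable (by simp)⟩
  · exact ⟨i, hx, .rfl⟩
  · by_cases h : ∃ k : Fin q, k ≤ j ∧ Sum.inr (Sum.inr k) = v
    · obtain ⟨k, hkj, rfl⟩ := h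
      have hkj' : k.val < j.val := by
        have : j ≠ k := by simpa using hx
        omega
      refine ⟨⟨2, by omega⟩, by simp, ?_⟩
      obtain ⟨d, hd⟩ : ∃ d, d = q - 1 - j.val := ⟨_, rfl⟩
      clear hkj
      induction d generalizing j with
      | zero => exact SimpleGraph.Adj.reachable (by simp; omega)
      | succ d ih =>
        have hne : (Sum.inr (Sum.inr ⟨j.val + 1, by omega⟩) : V ⊕ (Fin p ⊕ Fin q)) ≠
            Sum.inr (Sum.inr k) := by
          simp [Fin.ext_iff]; omega
        refine SimpleGraph.Reachable.trans (SimpleGraph.Adj.reachable ?_)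
          (ih ⟨j.val + 1, by omega⟩ hne (by simp; omega) (by simp; omega))
        simp
    · push Not at h
      by_cases hv : (Sum.inr (Sum.inl ⟨1, by omega⟩) : V ⊕ (Fin p ⊕ Fin q)) = v
      · subst hv
        refine ⟨⟨2, by omega⟩, by simp, ?_⟩
        obtain ⟨d, hd⟩ : ∃ d, d = q - 1 - j.val := ⟨_, rfl⟩
        clear h
        induction d generalizing j with
        | zero => exact SimpleGraph.Adj.reachable (by simp; omega)
        | succ d ih =>
          refine SimpleGraph.Reachable.trans (SimpleGraph.Adj.reachable ?_)
            (ih ⟨j.val + 1, by omega⟩ (by simp) (by simp; omega))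
          simp
      · refine ⟨⟨1, by omega⟩, hv, ?_⟩
        obtain ⟨d, hd⟩ : ∃ d, d = j.val := ⟨_, rfl⟩
        induction d generalizing j with
        | zero => exact SimpleGraph.Adj.reachable (by simp; omega)
        | succ d ih =>
          refine SimpleGraph.Reachable.trans (SimpleGraph.Adj.reachable ?_)
            (ih ⟨j.val - 1, by omega⟩ (h _ (by simp [Fin.le_def])) (fun k hk => h k ?_)
              (by simp; omega))
          · simp; omega
          · simp only [Fin.le_def] at hk ⊢
            omega

theorem induce_compl_singleton_connected (hp : 3 ≤ p) (v : V ⊕ (Fin p ⊕ Fin q)) :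
    ((cycleHardnessGraph G p q).induce ({v}ᶜ : Set (V ⊕ (Fin p ⊕ Fin q)))).Connected := by
  rw [SimpleGraph.connected_iff]
  constructor
  · rintro ⟨x, hx⟩ ⟨y, hy⟩
    obtain ⟨i, hi, hxi⟩ := exists_clique_reachable (G := G) hp v x hx
    obtain ⟨j, hj, hyj⟩ := exists_clique_reachable (G := G) hp v y hy
    refine (hxi.trans ?_).trans hyj.symm
    by_cases hij : i = j
    · subst hij
      rfl
    · exact SimpleGraph.Adj.reachable (by simpa using hij)
  · by_cases h : (Sum.inr (Sum.inl ⟨0, by omega⟩) : V ⊕ (Fin p ⊕ Fin q)) = v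
    · exact ⟨⟨Sum.inr (Sum.inl ⟨1, by omega⟩), by simp [← h]⟩⟩
    · exact ⟨⟨_, h⟩⟩

theorem connected (hp : 3 ≤ p) : (cycleHardnessGraph G p q).Connected := by
  rw [SimpleGraph.connected_iff]
  refine ⟨fun x y => ?_, ⟨Sum.inr (Sum.inl ⟨0, by omega⟩)⟩⟩
  obtain ⟨v, hvx, hvy⟩ : ∃ v : V ⊕ (Fin p ⊕ Fin q), x ≠ v ∧ y ≠ v := by
    by_contra! h
    have h0 := h (Sum.inr (Sum.inl ⟨0, by omega⟩))
    have h1 := h (Sum.inr (Sum.inl ⟨1, by omega⟩))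
    have h2 := h (Sum.inr (Sum.inl ⟨2, by omega⟩))
    by_cases hx : x = Sum.inr (Sum.inl ⟨0, by omega⟩)
    · subst hx
      have := (h1 (by simp)).symm.trans (h2 (by simp))
      simp at this
    · by_cases hx' : x = Sum.inr (Sum.inl ⟨1, by omega⟩)
      · subst hx'
        have := (h0 hx).symm.trans (h2 (by simp))
        simp at this
      · have := (h0 hx).symm.trans (h1 hx')
        simp at this
  exact ((induce_compl_singleton_connected (G := G) hp v).preconnected ⟨x, hvx⟩ ⟨y, hvy⟩).map
    (SimpleGraph.Embedding.induce _).toHom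

/-! ### Degeneracy -/

lemma ncard_range_clique_diff (i : Fin p) :
    (Set.range (fun j : Fin p => (Sum.inr (Sum.inl j) : V ⊕ (Fin p ⊕ Fin q))) \
      {Sum.inr (Sum.inl i)}).ncard = p - 1 := by
  rw [Set.ncard_sdiff_singleton_of_mem (Set.mem_range_self i), ← Set.image_univ,
    Set.ncard_image_of_injective _ fun a b h => by simpa using h, Set.ncard_univ,
    Nat.card_eq_fintype_card, Fintype.card_fin]

theorem degeneracy_eq [Fintype V] (hp : 5 ≤ p) (hV : Fintype.card V + 3 ≤ p) :
    (cycleHardnessGraph G p q).degeneracy = p - 1 := by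
  have upper : ∀ d ∈ {d : ℕ | ∃ s : Set (V ⊕ (Fin p ⊕ Fin q)), s.Nonempty ∧
      ∀ v ∈ s, d ≤ ((cycleHardnessGraph G p q).neighborSet v ∩ s).ncard}, d ≤ p - 1 := by
    rintro d ⟨s, hs, hd⟩
    by_cases hl : ∃ a : V, Sum.inl a ∈ s
    · obtain ⟨a, ha⟩ := hl
      have hsub : (cycleHardnessGraph G p q).neighborSet (Sum.inl a) ∩ s ⊆
          Set.range Sum.inl ∪ {Sum.inr (Sum.inl ⟨0, by omega⟩),
            Sum.inr (Sum.inl ⟨1, by omega⟩)} := by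
        rintro (b | i | j) ⟨hb, -⟩
        · simp
        · simp only [SimpleGraph.mem_neighborSet, adj_inl_clique] at hb
          simp [Fin.ext_iff]
          omega
        · simp at hb
      have h1 := Set.ncard_le_ncard hsub
      have h2 := Set.ncard_union_le (Set.range (Sum.inl : V → V ⊕ (Fin p ⊕ Fin q)))
        {Sum.inr (Sum.inl ⟨0, by omega⟩), Sum.inr (Sum.inl ⟨1, by omega⟩)}
      rw [← Set.image_univ, Set.ncard_image_of_injective _ Sum.inl_injective, Set.ncard_univ,
        Nat.card_eq_fintype_card, Set.ncard_pair (by simp), Set.image_univ] at h2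
      have := hd _ ha
      omega
    · by_cases hr : ∃ j : Fin q, Sum.inr (Sum.inr j) ∈ s
      · obtain ⟨j, hj⟩ := hr
        let g : ℕ → V ⊕ (Fin p ⊕ Fin q) := fun k =>
          if h : k < q then Sum.inr (Sum.inr ⟨k, h⟩) else Sum.inr (Sum.inr j)
        have hsub : (cycleHardnessGraph G p q).neighborSet (Sum.inr (Sum.inr j)) ∩ s ⊆
            {Sum.inr (Sum.inl ⟨1, by omega⟩), Sum.inr (Sum.inl ⟨2, by omega⟩),
              g (j.val - 1), g (j.val + 1)} := by
          rintro (b | i | k) ⟨hb, -⟩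
          · simp at hb
          · simp only [SimpleGraph.mem_neighborSet, adj_path_clique] at hb
            simp only [Set.mem_insert_iff, Sum.inr.injEq, Sum.inl.injEq, Fin.ext_iff]
            omega
          · simp only [SimpleGraph.mem_neighborSet, adj_path_path] at hb
            have hg : (Sum.inr (Sum.inr k) : V ⊕ (Fin p ⊕ Fin q)) = g k.val := by simp [g]
            rw [hg]
            rcases hb with hb | hb
            · simp [hb]
            · simp [hb]
        have h1 := Set.ncard_le_ncard hsub
        have h2 := (Set.ncard_insert_le (Sum.inr (Sum.inl ⟨1, by omega⟩))
          {Sum.inr (Sum.inl ⟨2, by omega⟩), g (j.val - 1), g (j.val + 1)})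
        have h3 := (Set.ncard_insert_le (Sum.inr (Sum.inl ⟨2, by omega⟩))
          {g (j.val - 1), g (j.val + 1)})
        have h4 := (Set.ncard_insert_le (g (j.val - 1)) {g (j.val + 1)})
        rw [Set.ncard_singleton] at h4
        have := hd _ hj
        omega
      · obtain ⟨x, hx⟩ := hs
        rcases x with a | i | j
        · exact (hl ⟨a, hx⟩).elim
        · refine (hd _ hx).trans ((Set.ncard_le_ncard ?_).trans (ncard_range_clique_diff i).le)
          rintro (b | k | k) ⟨hk, hks⟩
          · exact (hl ⟨b, hks⟩).elim
          · simp only [SimpleGraph.mem_neighborSet, adj_clique_clique] at hk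
            simpa using hk.symm
          · exact (hr ⟨k, hks⟩).elim
        · exact (hr ⟨j, hx⟩).elim
  have lower : p - 1 ∈ {d : ℕ | ∃ s : Set (V ⊕ (Fin p ⊕ Fin q)), s.Nonempty ∧
      ∀ v ∈ s, d ≤ ((cycleHardnessGraph G p q).neighborSet v ∩ s).ncard} := by
    refine ⟨Set.range (fun j : Fin p => Sum.inr (Sum.inl j)), ⟨_, ⟨0, by omega⟩, rfl⟩, ?_⟩
    rintro _ ⟨i, rfl⟩
    refine (ncard_range_clique_diff i).ge.trans (Set.ncard_le_ncard ?_)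
    rintro _ ⟨⟨k, rfl⟩, hk⟩
    refine ⟨?_, ⟨k, rfl⟩⟩
    simp only [SimpleGraph.mem_neighborSet, adj_clique_clique]
    rintro rfl
    simp at hk
  exact le_antisymm (csSup_le ⟨_, lower⟩ upper) (le_csSup ⟨_, upper⟩ lower)

end cycleHardnessGraph

/-! ### Hamiltonicity -/

lemma SimpleGraph.exists_isCycle_of_isChain {W : Type*} {H : SimpleGraph W} {x : W} {l : List W}
    (hl : 2 ≤ l.length) (hchain : (x :: l).IsChain H.Adj) (hnodup : (x :: l).Nodup)
    (hlast : H.Adj ((x :: l).getLast (List.cons_ne_nil x l)) x) :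
    ∃ c : H.Walk x x, c.IsCycle ∧ c.length = l.length + 1 := by
  let P : H.Walk x ((x :: l).getLast (List.cons_ne_nil x l)) :=
    SimpleGraph.Walk.ofSupport (x :: l) (List.cons_ne_nil x l) hchain
  have hsupp : P.support = x :: l := SimpleGraph.Walk.support_ofSupport _ hchain
  have hlen : P.length = l.length := by
    simpa using SimpleGraph.Walk.length_ofSupport (List.cons_ne_nil x l) hchain
  refine ⟨P.append (.cons hlast .nil), SimpleGraph.Walk.IsPath.isCycle_append ?_ ?_ ?_ ?_, ?_⟩
  · rw [SimpleGraph.Walk.isPath_def, hsupp]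
    exact hnodup
  · simp [hlast.ne]
  · rw [hsupp]
    simpa using (List.nodup_cons.mp hnodup).1
  · left
    omega
  · simp [hlen]

namespace cycleHardnessGraph

variable {V : Type*} {G : SimpleGraph V}

theorem exists_isCycle_of_isPath [Fintype V] {k r : ℕ} {u v : V} (w : G.Walk u v)
    (hw : w.IsPath) (hw' : ∀ x, x ∈ w.support) :
    ∃ (x : V ⊕ (Fin (k + 3) ⊕ Fin (r + 1)))
      (c : (cycleHardnessGraph G (k + 3) (r + 1)).Walk x x),
      c.IsCycle ∧ c.length = Fintype.card (V ⊕ (Fin (k + 3) ⊕ Fin (r + 1))) := by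
  classical
  have hlen : w.support.length = Fintype.card V := by
    rw [← List.toFinset_card_of_nodup hw.support_nodup, ← Finset.card_univ]
    congr 1
    ext x
    simp [hw' x]
  let W : List (V ⊕ (Fin (k + 3) ⊕ Fin (r + 1))) := List.ofFn fun j => Sum.inr (Sum.inr j)
  let U : List (V ⊕ (Fin (k + 3) ⊕ Fin (r + 1))) :=
    List.ofFn fun j : Fin (k + 1) => Sum.inr (Sum.inl j.succ.succ)
  let u₁ : V ⊕ (Fin (k + 3) ⊕ Fin (r + 1)) := Sum.inr (Sum.inl 0)
  let u₂ : V ⊕ (Fin (k + 3) ⊕ Fin (r + 1)) := Sum.inr (Sum.inl 1)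
  have hchain : (u₁ :: (w.support.map Sum.inl ++ u₂ :: (W ++ U))).IsChain
      (cycleHardnessGraph G (k + 3) (r + 1)).Adj := by
    have hV : (w.support.map Sum.inl).IsChain (cycleHardnessGraph G (k + 3) (r + 1)).Adj :=
      List.isChain_map_of_isChain _ (fun a b h => adj_inl_inl.mpr h) w.isChain_adj_support
    have hW : W.IsChain (cycleHardnessGraph G (k + 3) (r + 1)).Adj := by
      rw [List.isChain_ofFn]
      simp
    have hU : U.IsChain (cycleHardnessGraph G (k + 3) (r + 1)).Adj := by
      rw [List.isChain_ofFn]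
      simp
    have hWU : (W ++ U).IsChain (cycleHardnessGraph G (k + 3) (r + 1)).Adj := by
      refine List.IsChain.append hW hU ?_
      intro x hx y hy
      simp only [W, List.ofFn_succ_last, List.getLast?_append, List.getLast?_singleton,
        Option.some_or, Option.mem_def, Option.some.injEq] at hx
      simp only [U, List.ofFn_succ, List.head?_cons, Option.mem_def, Option.some.injEq] at hy
      subst hx hy
      simp
    have hu₂ : (u₂ :: (W ++ U)).IsChain (cycleHardnessGraph G (k + 3) (r + 1)).Adj := by
      refine hWU.cons ?_
      intro y hy
      simp only [W, List.ofFn_succ, List.cons_append, List.head?_cons, Option.mem_def,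
        Option.some.injEq] at hy
      subst hy
      simp [u₂]
    refine List.IsChain.cons (List.IsChain.append hV hu₂ ?_) ?_
    · intro x hx y hy
      have hx := List.mem_of_mem_getLast? hx
      simp only [List.head?_cons, Option.mem_def, Option.some.injEq] at hy
      obtain ⟨a, -, rfl⟩ := List.mem_map.mp hx
      subst hy
      simp [u₂]
    · intro y hy
      rw [List.head?_append_of_ne_nil _ (by simp)] at hy
      obtain ⟨a, -, rfl⟩ := List.mem_map.mp (List.mem_of_mem_head? hy)
      simp [u₁]
  have hnodup : (u₁ :: (w.support.map Sum.inl ++ u₂ :: (W ++ U))).Nodup := by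
    have hW : W.Nodup := List.nodup_ofFn_ofInjective (Sum.inr_injective.comp Sum.inr_injective)
    have hU : U.Nodup := List.nodup_ofFn_ofInjective (Sum.inr_injective.comp
      (Sum.inl_injective.comp ((Fin.succ_injective _).comp (Fin.succ_injective _))))
    have hV : (w.support.map (Sum.inl : V → V ⊕ (Fin (k + 3) ⊕ Fin (r + 1)))).Nodup :=
      hw.support_nodup.map Sum.inl_injective
    simp only [List.nodup_cons, List.nodup_append', hV, hW, hU]
    simp [W, U, u₁, u₂, List.disjoint_left, Fin.ext_iff, Nat.mod_eq_of_lt]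
  have hlast : (u₁ :: (w.support.map Sum.inl ++ u₂ :: (W ++ U))).getLast (by simp) =
      Sum.inr (Sum.inl (Fin.last (k + 2))) := by
    simp only [U, List.ofFn_succ_last, ← List.cons_append, ← List.append_assoc,
      List.getLast_append_singleton, Fin.succ_last]
  obtain ⟨c, hc, hcl⟩ := SimpleGraph.exists_isCycle_of_isChain
    (by simp [W, U]; omega) hchain hnodup (by rw [hlast]; simp [u₁, Fin.ext_iff])
  refine ⟨_, c, hc, ?_⟩
  rw [hcl]
  simp [W, U, hlen]
  omega

lemma forall_isLeft_or_forall_isRight {k q : ℕ} {l : List (V ⊕ (Fin (k + 3) ⊕ Fin q))}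
    (hchain : l.IsChain (cycleHardnessGraph G (k + 3) q).Adj)
    (h₁ : Sum.inr (Sum.inl 0) ∉ l) (h₂ : Sum.inr (Sum.inl 1) ∉ l) :
    (∀ x ∈ l, x.isLeft) ∨ (∀ x ∈ l, x.isRight) := by
  induction l with
  | nil => simp
  | cons x l ih =>
    cases l with
    | nil => cases x <;> simp
    | cons y l =>
      have hxy := hchain.rel
      have := ih hchain.of_cons (fun h => h₁ (List.mem_cons_of_mem _ h))
        (fun h => h₂ (List.mem_cons_of_mem _ h))
      have hside : x.isLeft = y.isLeft := by
        rcases x with a | i | j <;> rcases y with b | i' | j' <;> simp_all [Fin.ext_iff] <;> omega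
      rcases x <;> rcases y <;> simp_all

lemma exists_isPath_of_isChain [Nonempty V] {p q : ℕ} {l : List (V ⊕ (Fin p ⊕ Fin q))}
    (hchain : l.IsChain (cycleHardnessGraph G p q).Adj) (hnodup : l.Nodup)
    (hleft : ∀ x ∈ l, x.isLeft) (hall : ∀ a : V, Sum.inl a ∈ l) :
    ∃ (u v : V) (w : G.Walk u v), w.IsPath ∧ ∀ x : V, x ∈ w.support := by
  obtain ⟨m, rfl⟩ : ∃ m : List V, m.map Sum.inl = l := by
    have : l ∈ Set.range (List.map (Sum.inl : V → V ⊕ (Fin p ⊕ Fin q))) := by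
      rw [Set.range_list_map]
      intro x hx
      obtain ⟨a, rfl⟩ := Sum.isLeft_iff.mp (hleft x hx)
      exact ⟨a, rfl⟩
    exact this
  have hm : ∀ a, a ∈ m := by simpa using hall
  have hne : m ≠ [] := List.ne_nil_of_mem (hm (Classical.arbitrary V))
  have hmc : m.IsChain G.Adj :=
    List.isChain_of_isChain_map _ (fun a b h => adj_inl_inl.mp h) hchain
  refine ⟨_, _, SimpleGraph.Walk.ofSupport m hne hmc, ?_, ?_⟩
  · rw [SimpleGraph.Walk.isPath_def, SimpleGraph.Walk.support_ofSupport]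
    exact hnodup.of_map _
  · rw [SimpleGraph.Walk.support_ofSupport]
    exact hm

theorem exists_isPath_of_isHamiltonianCycle [Nonempty V] [DecidableEq V] {k q : ℕ}
    {x : V ⊕ (Fin (k + 3) ⊕ Fin q)} {c : (cycleHardnessGraph G (k + 3) q).Walk x x}
    (hc : c.IsHamiltonianCycle) :
    ∃ (u v : V) (w : G.Walk u v), w.IsPath ∧ ∀ x : V, x ∈ w.support := by
  obtain ⟨c', hc'⟩ : ∃ c' : (cycleHardnessGraph G (k + 3) q).Walk (Sum.inr (Sum.inl 0))
      (Sum.inr (Sum.inl 0)), c'.IsHamiltonianCycle :=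
    ⟨_, hc.rotate (hc.mem_support _)⟩
  obtain ⟨t, ht⟩ : ∃ t, c'.support = Sum.inr (Sum.inl 0) :: (t ++ [Sum.inr (Sum.inl 0)]) := by
    have hne : c'.support.tail ≠ [] := by
      intro h
      have := congrArg List.length h
      have := hc'.isCycle.three_le_length
      simp only [List.length_tail, SimpleGraph.Walk.length_support, List.length_nil] at *
      omega
    refine ⟨c'.support.tail.dropLast, ?_⟩
    have hlast : c'.support.tail.getLast hne = Sum.inr (Sum.inl 0) := by
      rw [List.getLast_tail, SimpleGraph.Walk.getLast_support]
    conv_lhs => rw [← SimpleGraph.Walk.cons_tail_support, ← List.dropLast_append_getLast hne, hlast]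
  have hnodup : (t ++ [Sum.inr (Sum.inl 0)]).Nodup := by
    have := hc'.isCycle.support_nodup
    rwa [ht] at this
  have hmem : ∀ y, y ∈ t ∨ y = Sum.inr (Sum.inl 0) := by
    intro y
    have := hc'.mem_support y
    rw [ht] at this
    simp at this
    tauto
  have hchain := c'.isChain_adj_support
  rw [ht] at hchain
  obtain ⟨l, m, rfl⟩ := List.append_of_mem ((hmem (Sum.inr (Sum.inl 1))).resolve_right (by simp))
  have hl : l.IsChain (cycleHardnessGraph G (k + 3) q).Adj :=
    hchain.infix ⟨[Sum.inr (Sum.inl 0)], Sum.inr (Sum.inl 1) :: m ++ [Sum.inr (Sum.inl 0)],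
      by simp⟩
  have hm : m.IsChain (cycleHardnessGraph G (k + 3) q).Adj :=
    hchain.infix ⟨Sum.inr (Sum.inl 0) :: l ++ [Sum.inr (Sum.inl 1)], [Sum.inr (Sum.inl 0)],
      by simp⟩
  simp only [List.nodup_append', List.nodup_cons, List.disjoint_left, List.mem_append,
    List.mem_cons] at hnodup
  simp only [List.mem_append, List.mem_cons] at hmem
  have hinl : ∀ a : V, Sum.inl a ∈ l ∨ Sum.inl a ∈ m := by
    intro a
    simpa using hmem (Sum.inl a)
  have hu₃ : Sum.inr (Sum.inl 2) ∈ l ∨ Sum.inr (Sum.inl 2) ∈ m := by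
    have h20 : (2 : Fin (k + 3)) ≠ 0 := by simp [Fin.ext_iff, Nat.mod_eq_of_lt]
    have h21 : (2 : Fin (k + 3)) ≠ 1 := by simp [Fin.ext_iff, Nat.mod_eq_of_lt]
    simpa [h20, h21] using hmem (Sum.inr (Sum.inl 2))
  have hl0 : Sum.inr (Sum.inl 0) ∉ l := by grind
  have hm0 : Sum.inr (Sum.inl 0) ∉ m := by grind
  have hl1 : Sum.inr (Sum.inl 1) ∉ l := by grind
  have hm1 : Sum.inr (Sum.inl 1) ∉ m := by grind
  rcases forall_isLeft_or_forall_isRight hl hl0 hl1 with hls | hls <;>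
    rcases forall_isLeft_or_forall_isRight hm hm0 hm1 with hms | hms
  · rcases hu₃ with h | h
    · simpa using hls _ h
    · simpa using hms _ h
  · exact exists_isPath_of_isChain hl hnodup.1.1 hls
      fun a => (hinl a).resolve_right fun h => by simpa using hms _ h
  · exact exists_isPath_of_isChain hm hnodup.1.2.1.2 hms
      fun a => (hinl a).resolve_left fun h => by simpa using hls _ h
  · rcases hinl (Classical.arbitrary V) with h | h
    · simpa using hls _ h
    · simpa using hms _ h

end cycleHardnessGraph

/-- Let `0 < ε < 1`, let `G` be a graph on `n ≥ 2` vertices, let `p = 2⌈n/ε⌉` and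
`q = ⌈(1+ε)(p-1)⌉ - (n+p)`, and let `G'` be the graph of the reduction. Then
`q ≥ 1`, `G'` is 2-connected, `dg(G') = p - 1`, `G'` has exactly `⌈(1+ε)(p-1)⌉`
vertices, and `G'` has a cycle with at least `(1+ε)·dg(G')` vertices iff `G` has a
Hamiltonian path. -/
theorem cycle_above_degeneracy_tight {V : Type*} [Fintype V] (G : SimpleGraph V)
    (ε : ℝ) (hε0 : 0 < ε) (hε1 : ε < 1) (hn : 2 ≤ Fintype.card V)
    (p q : ℕ)
    (hp : (p : ℤ) = 2 * ⌈(Fintype.card V : ℝ) / ε⌉)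
    (hq : (q : ℤ) = ⌈(1 + ε) * ((p : ℝ) - 1)⌉ - (Fintype.card V + p)) :
    1 ≤ q ∧
    (cycleHardnessGraph G p q).Connected ∧
    (∀ v : V ⊕ (Fin p ⊕ Fin q),
      ((cycleHardnessGraph G p q).induce ({v}ᶜ : Set (V ⊕ (Fin p ⊕ Fin q)))).Connected) ∧
    (cycleHardnessGraph G p q).degeneracy = p - 1 ∧
    ((Fintype.card (V ⊕ (Fin p ⊕ Fin q)) : ℤ) = ⌈(1 + ε) * ((p : ℝ) - 1)⌉) ∧
    ((∃ (v : V ⊕ (Fin p ⊕ Fin q)) (c : (cycleHardnessGraph G p q).Walk v v),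
        c.IsCycle ∧ (1 + ε) * ((cycleHardnessGraph G p q).degeneracy : ℝ) ≤ c.length) ↔
     (∃ (u v : V) (w : G.Walk u v), w.IsPath ∧ ∀ x : V, x ∈ w.support)) := by
  classical
  have hnV : (2 : ℝ) ≤ Fintype.card V := by exact_mod_cast hn
  have hdiv : (Fintype.card V : ℝ) < (Fintype.card V : ℝ) / ε := by
    rw [lt_div_iff₀ hε0]
    nlinarith
  have hceil : (Fintype.card V : ℤ) + 1 ≤ ⌈(Fintype.card V : ℝ) / ε⌉ := by
    rw [Int.add_one_le_iff, Int.lt_ceil]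
    exact_mod_cast hdiv
  have hpV : 2 * Fintype.card V + 2 ≤ p := by omega
  have hpε : 2 * (Fintype.card V : ℝ) ≤ p * ε := by
    have h1 : (p : ℝ) = 2 * (⌈(Fintype.card V : ℝ) / ε⌉ : ℤ) := by exact_mod_cast hp
    have h2 := Int.le_ceil ((Fintype.card V : ℝ) / ε)
    rw [div_le_iff₀ hε0] at h2
    rw [h1]
    linarith
  have hq1 : 1 ≤ q := by
    have h1 := Int.le_ceil ((1 + ε) * ((p : ℝ) - 1))
    have h2 : (q : ℝ) = (⌈(1 + ε) * ((p : ℝ) - 1)⌉ : ℤ) - (Fintype.card V + p) := by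
      exact_mod_cast hq
    have h3 : (0 : ℝ) < q := by nlinarith
    exact_mod_cast h3
  have hcard : (Fintype.card (V ⊕ (Fin p ⊕ Fin q)) : ℤ) = ⌈(1 + ε) * ((p : ℝ) - 1)⌉ := by
    simp only [Fintype.card_sum, Fintype.card_fin]
    push_cast
    linarith
  have hdeg : (cycleHardnessGraph G p q).degeneracy = p - 1 :=
    cycleHardnessGraph.degeneracy_eq (by omega) (by omega)
  refine ⟨hq1, cycleHardnessGraph.connected (by omega),
    cycleHardnessGraph.induce_compl_singleton_connected (by omega), hdeg, hcard, ?_⟩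
  have hcast : ((p - 1 : ℕ) : ℝ) = (p : ℝ) - 1 := by
    rw [Nat.cast_sub (by omega), Nat.cast_one]
  rw [hdeg, hcast]
  have hiff : ∀ m : ℕ, (1 + ε) * ((p : ℝ) - 1) ≤ m ↔
      Fintype.card (V ⊕ (Fin p ⊕ Fin q)) ≤ m := by
    intro m
    rw [← Int.ofNat_le, hcard, Int.ceil_le, Int.cast_natCast]
  simp only [hiff]
  clear hiff hcast hdeg hcard hp hq hpε
  obtain ⟨k, rfl⟩ : ∃ k, p = k + 3 := ⟨p - 3, by omega⟩
  obtain ⟨r, rfl⟩ : ∃ r, q = r + 1 := ⟨q - 1, by omega⟩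
  have : Nonempty V := Fintype.card_pos_iff.mp (by omega)
  constructor
  · rintro ⟨x, c, hc, hlen⟩
    refine cycleHardnessGraph.exists_isPath_of_isHamiltonianCycle (c := c) ?_
    rw [SimpleGraph.Walk.isHamiltonianCycle_iff_isCycle_and_length_eq]
    refine ⟨hc, le_antisymm ?_ hlen⟩
    simpa using hc.support_nodup.length_le_card
  · rintro ⟨u, v, w, hw, hw'⟩
    obtain ⟨x, c, hc, hlen⟩ := cycleHardnessGraph.exists_isCycle_of_isPath w hw hw'
    exact ⟨x, c, hc, hlen.ge⟩
end
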